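/- Let F_1 and F_2 be fact bases with F_1 ⊨ F_2, and let R be a disjunctive rule such that there exists a trigger (R, h_2) on F_2. Then there exists a trigger (R, h_1) on F_1 such that α_∨(F_1, R, h_1) ⊨ α_∨(F_2, R, h_2), i.e., for each of the n produced fact bases F_2 ∪ h_2^{safe_i}(H_i) there is a homomorphism from it to the corresponding fact base F_1 ∪ h_1^{safe_i}(H_i). -/

import Mathlib

/-! ## Basic syntax: terms, atoms, substitutions -/

/-- A term over variables `V` and constants `C`. -/
inductive FOTerm (V C : Type) where
  | var (v : V)
  | const (c : C)
deriving DecidableEq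

/-- An atom `p(t_1,...,t_n)`. -/
structure FOAtom (P V C : Type) where
  pred : P
  args : List (FOTerm V C)
deriving DecidableEq

/-- A substitution of variables by terms. -/
abbrev FOSubst (V C : Type) := V → FOTerm V C

variable {P V C : Type}

def FOTerm.applySub (u : FOSubst V C) : FOTerm V C → FOTerm V C
  | FOTerm.var v => u v
  | FOTerm.const c => FOTerm.const c

def FOAtom.applySub (u : FOSubst V C) (a : FOAtom P V C) : FOAtom P V C :=
  ⟨a.pred, a.args.map (FOTerm.applySub u)⟩

def applySubFS [DecidableEq P] [DecidableEq V] [DecidableEq C]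
    (u : FOSubst V C) (S : Finset (FOAtom P V C)) : Finset (FOAtom P V C) :=
  S.image (FOAtom.applySub u)

def FOTerm.varsOf [DecidableEq V] : FOTerm V C → Finset V
  | FOTerm.var v => {v}
  | FOTerm.const _ => ∅

def FOAtom.varsOf [DecidableEq V] (a : FOAtom P V C) : Finset V :=
  a.args.foldr (fun t acc => t.varsOf ∪ acc) ∅

/-- Variables occurring in a finite set of atoms. -/
def varsFS [DecidableEq V] (S : Finset (FOAtom P V C)) : Finset V :=
  S.sup FOAtom.varsOf

/-- Terms occurring in a finite set of atoms. -/
def termsFS [DecidableEq V] [DecidableEq C] (S : Finset (FOAtom P V C)) :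
    Finset (FOTerm V C) :=
  S.sup (fun a => a.args.toFinset)

/-- `h` is a homomorphism from the atom set `S₁` to the atom set `S₂`. -/
def IsHom (h : FOSubst V C) (S₁ S₂ : Finset (FOAtom P V C)) : Prop :=
  ∀ a ∈ S₁, a.applySub h ∈ S₂

/-- `S₂ ⊨ S₁` for atom sets viewed as existentially closed conjunctions:
there is a homomorphism from `S₁` to `S₂`. -/
def EntailsFS (S₂ S₁ : Finset (FOAtom P V C)) : Prop :=
  ∃ h : FOSubst V C, IsHom h S₁ S₂

/-! ## Disjunctive existential rules, triggers, chase step α -/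

/-- A disjunctive existential rule `B → H₁ ∨ ... ∨ Hₙ`. -/
structure DisjRule (P V C : Type) where
  body : Finset (FOAtom P V C)
  heads : List (Finset (FOAtom P V C))

/-- Well-formedness: non-empty body, at least one head disjunct, non-empty disjuncts. -/
def DisjRule.WF (R : DisjRule P V C) : Prop :=
  R.body.Nonempty ∧ R.heads ≠ [] ∧ ∀ H ∈ R.heads, H.Nonempty

/-- All variables of a rule. -/
def DisjRule.vars [DecidableEq V] (R : DisjRule P V C) : Finset V :=
  varsFS R.body ∪ R.heads.foldr (fun H acc => varsFS H ∪ acc) ∅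

/-- A trigger `(R, h)` on `F`: `h` is a homomorphism from the body of `R` to `F`. -/
def IsTrigger (R : DisjRule P V C) (h : FOSubst V C) (F : Finset (FOAtom P V C)) : Prop :=
  IsHom h R.body F

/-- `h'` is a safe extension of `h` for the head disjunct `H` of rule `R` w.r.t. the
fact base `F`: it agrees with `h` outside the existential variables of `H` and renames
the existential variables of `H` injectively to fresh variables. -/
def IsSafeExt [DecidableEq V] (F : Finset (FOAtom P V C)) (R : DisjRule P V C)
    (H : Finset (FOAtom P V C)) (h h' : FOSubst V C) : Prop :=
  (∀ v : V, v ∉ varsFS H \ varsFS R.body → h' v = h v) ∧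
  (∀ v ∈ varsFS H \ varsFS R.body, ∃ w : V, h' v = FOTerm.var w ∧ w ∉ varsFS F) ∧
  (∀ v ∈ varsFS H \ varsFS R.body, ∀ v' ∈ varsFS H \ varsFS R.body,
      h' v = h' v' → v = v')

/-- `L` is a result of the application `α_∨(F, R, h)` of the trigger `(R, h)` on `F`:
its `i`-th element is `F ∪ h^{safeᵢ}(Hᵢ)`. -/
def IsAlpha [DecidableEq P] [DecidableEq V] [DecidableEq C]
    (F : Finset (FOAtom P V C)) (R : DisjRule P V C) (h : FOSubst V C)
    (L : List (Finset (FOAtom P V C))) : Prop :=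
  L.length = R.heads.length ∧
  ∀ (i : ℕ) (hi : i < L.length) (hi' : i < R.heads.length),
    ∃ h' : FOSubst V C, IsSafeExt F R (R.heads.get ⟨i, hi'⟩) h h' ∧
      L.get ⟨i, hi⟩ = F ∪ applySubFS h' (R.heads.get ⟨i, hi'⟩)

/-! ## Partitions of terms (as equivalence relations), piece-unifiers -/

/-- A relation on terms, representing a partition of a set of terms (two terms are
related iff they belong to the same class). -/
abbrev TRel (V C : Type) := FOTerm V C → FOTerm V C → Prop

/-- Admissibility of a partition: no class contains two distinct constants. -/
def RelAdmissible (r : TRel V C) : Prop :=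
  ∀ c c' : C, r (FOTerm.const c) (FOTerm.const c') → c = c'

/-- `u` is a substitution associated with the partition represented by `r`:
it is constant on classes, maps each term to a member of its class (the selected term),
and gives priority to constants. -/
def IsAssocSub (r : TRel V C) (u : FOSubst V C) : Prop :=
  (∀ s t, r s t → s.applySub u = t.applySub u) ∧
  (∀ t, r t (t.applySub u)) ∧
  (∀ (v : V) (c : C), r (FOTerm.var v) (FOTerm.const c) → u v = FOTerm.const c)

/-- The data of a piece-unifier `(Q', H', P_u)`. -/
structure PieceUnif (P V C : Type) where
  Q' : Finset (FOAtom P V C)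
  H' : Finset (FOAtom P V C)
  rel : TRel V C

/-- `μ` is a piece-unifier of the CQ `Q` with the conjunctive rule `B → H`. -/
def IsPieceUnifier [DecidableEq P] [DecidableEq V] [DecidableEq C]
    (Q : Finset (FOAtom P V C)) (B H : Finset (FOAtom P V C))
    (μ : PieceUnif P V C) : Prop :=
  μ.Q'.Nonempty ∧ μ.Q' ⊆ Q ∧ μ.H' ⊆ H ∧
  Equivalence μ.rel ∧
  -- the partition is on the terms of Q' and H' (all other classes are singletons)
  (∀ s t, μ.rel s t → s = t ∨
      (s ∈ termsFS μ.Q' ∪ termsFS μ.H' ∧ t ∈ termsFS μ.Q' ∪ termsFS μ.H')) ∧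
  RelAdmissible μ.rel ∧
  -- classes containing an existential variable of H' contain otherwise only
  -- non-separating variables of Q'
  (∀ z ∈ varsFS μ.H' \ varsFS B, ∀ t, μ.rel (FOTerm.var z) t → t = FOTerm.var z ∨
      ∃ v : V, t = FOTerm.var v ∧ FOTerm.var v ∈ termsFS μ.Q' ∧ v ∉ varsFS (Q \ μ.Q')) ∧
  -- unification condition
  (∀ u : FOSubst V C, IsAssocSub μ.rel u → applySubFS u μ.Q' = applySubFS u μ.H')

/-- The join of a list of partitions (represented as relations): the equivalence
relation generated by their union. -/
def joinRel (rs : List (TRel V C)) : TRel V C :=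
  Relation.EqvGen (fun s t => ∃ r ∈ rs, r s t)

/-- The data of a disjunctive piece-unifier: the safe copies `Q₁, ..., Qₙ` together
with the conjunctive piece-unifiers `μ₁, ..., μₙ`. -/
structure DisjPieceUnif (P V C : Type) where
  Qs : List (Finset (FOAtom P V C))
  mus : List (PieceUnif P V C)

/-- The join of the partitions of a disjunctive piece-unifier. -/
def DisjPieceUnif.rel (μ : DisjPieceUnif P V C) : TRel V C :=
  joinRel (μ.mus.map PieceUnif.rel)

/-- `Qc` is a safe copy of `Q` (bijective renaming of its variables). -/
def IsSafeCopy [DecidableEq P] [DecidableEq V] [DecidableEq C]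
    (Q Qc : Finset (FOAtom P V C)) : Prop :=
  ∃ ρ : V → V, Function.Injective ρ ∧
    Qc = Q.image (FOAtom.applySub (fun v => FOTerm.var (ρ v)))

/-- `μ` is a disjunctive piece-unifier of the UCQ `𝒬` with the disjunctive rule `R`. -/
def IsDisjPieceUnifier [DecidableEq P] [DecidableEq V] [DecidableEq C]
    (𝒬 : Set (Finset (FOAtom P V C))) (R : DisjRule P V C)
    (μ : DisjPieceUnif P V C) : Prop :=
  μ.Qs.length = R.heads.length ∧ μ.mus.length = R.heads.length ∧
  -- each Qᵢ is a safe copy of a CQ of 𝒬, with variables disjoint from the rule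
  -- and from the other copies
  (∀ (i : ℕ) (hi : i < μ.Qs.length), ∃ Q ∈ 𝒬, IsSafeCopy Q (μ.Qs.get ⟨i, hi⟩)) ∧
  (∀ (i : ℕ) (hi : i < μ.Qs.length), Disjoint (varsFS (μ.Qs.get ⟨i, hi⟩)) R.vars) ∧
  (∀ (i j : ℕ) (hi : i < μ.Qs.length) (hj : j < μ.Qs.length), i ≠ j →
      Disjoint (varsFS (μ.Qs.get ⟨i, hi⟩)) (varsFS (μ.Qs.get ⟨j, hj⟩))) ∧
  -- each μᵢ is a piece-unifier of Qᵢ with B → Hᵢ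
  (∀ (i : ℕ) (hi : i < R.heads.length) (hi1 : i < μ.Qs.length) (hi2 : i < μ.mus.length),
      IsPieceUnifier (μ.Qs.get ⟨i, hi1⟩) R.body (R.heads.get ⟨i, hi⟩)
        (μ.mus.get ⟨i, hi2⟩)) ∧
  -- the join of the partitions is admissible
  RelAdmissible μ.rel

/-- `β_∨(𝒬, R, μ) = u(B) ∪ ⋃ᵢ u(Qᵢ ∖ Qᵢ')`, for `u` a substitution associated with
the join of the partitions of `μ`. -/
def betaRw [DecidableEq P] [DecidableEq V] [DecidableEq C]
    (R : DisjRule P V C) (μ : DisjPieceUnif P V C) (u : FOSubst V C) :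
    Finset (FOAtom P V C) :=
  applySubFS u R.body ∪
    (List.zipWith (fun Qi m => applySubFS u (Qi \ PieceUnif.Q' m)) μ.Qs μ.mus).foldr
      (· ∪ ·) ∅

/-! ## Semantics -/

/-- A first-order interpretation (with non-empty domain). -/
structure Interp (P V C : Type) where
  dom : Type
  nonempty : Nonempty dom
  rel : P → List dom → Prop
  cst : C → dom

def Interp.evalT (I : Interp P V C) (a : V → I.dom) : FOTerm V C → I.dom
  | FOTerm.var v => a v
  | FOTerm.const c => I.cst c

def Interp.satAtom (I : Interp P V C) (a : V → I.dom) (atm : FOAtom P V C) : Prop :=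
  I.rel atm.pred (atm.args.map (I.evalT a))

def Interp.satFS (I : Interp P V C) (a : V → I.dom) (S : Finset (FOAtom P V C)) : Prop :=
  ∀ atm ∈ S, I.satAtom a atm

/-- `I` is a model of the atom set `S` viewed as an existentially closed conjunction. -/
def Interp.modelsFB [DecidableEq V] (I : Interp P V C) (S : Finset (FOAtom P V C)) : Prop :=
  ∃ a : V → I.dom, I.satFS a S

/-- `I` satisfies the disjunctive existential rule `R`. -/
def Interp.satRule [DecidableEq V] (I : Interp P V C) (R : DisjRule P V C) : Prop :=
  ∀ a : V → I.dom, I.satFS a R.body →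
    ∃ H ∈ R.heads, ∃ a' : V → I.dom,
      (∀ v ∈ varsFS R.body, a' v = a v) ∧ I.satFS a' H

/-- First-order entailment `F, ℛ ⊨ 𝒬` of a UCQ from a fact base and a set of
disjunctive existential rules. -/
def SemEntails [DecidableEq V] (F : Finset (FOAtom P V C)) (ℛ : Set (DisjRule P V C))
    (𝒬 : Set (Finset (FOAtom P V C))) : Prop :=
  ∀ I : Interp P V C, I.modelsFB F → (∀ R ∈ ℛ, I.satRule R) →
    ∃ Q ∈ 𝒬, I.modelsFB Q

/-! ## Piece-rewriting -/

/-- `IsPieceRewriting ℛ 𝒬 𝒬'` holds when the UCQ `𝒬'` is obtained from the UCQ `𝒬`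
by a finite sequence of one-step piece-rewritings with rules of `ℛ`. -/
inductive IsPieceRewriting [DecidableEq P] [DecidableEq V] [DecidableEq C]
    (ℛ : Set (DisjRule P V C)) :
    Finset (Finset (FOAtom P V C)) → Finset (Finset (FOAtom P V C)) → Prop
  | refl (𝒬 : Finset (Finset (FOAtom P V C))) : IsPieceRewriting ℛ 𝒬 𝒬
  | step (𝒬 𝒬' : Finset (Finset (FOAtom P V C))) (R : DisjRule P V C)
      (μ : DisjPieceUnif P V C) (u : FOSubst V C) :
      IsPieceRewriting ℛ 𝒬 𝒬' → R ∈ ℛ →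
      IsDisjPieceUnifier (↑𝒬' : Set (Finset (FOAtom P V C))) R μ →
      IsAssocSub μ.rel u →
      IsPieceRewriting ℛ 𝒬 (insert (betaRw R μ u) 𝒬')

lemma FOTerm.applySub_congr [DecidableEq V] {u u' : FOSubst V C} {t : FOTerm V C}
    (h : ∀ v ∈ t.varsOf, u v = u' v) : t.applySub u = t.applySub u' := by
  cases t with
  | var v => exact h v (by simp [FOTerm.varsOf])
  | const c => rfl

lemma FOTerm.applySub_applySub (u u' : FOSubst V C) (t : FOTerm V C) :
    (t.applySub u).applySub u' = t.applySub (fun v => (u v).applySub u') := by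
  cases t <;> rfl

lemma FOAtom.mem_varsOf [DecidableEq V] {a : FOAtom P V C} {v : V} :
    v ∈ a.varsOf ↔ FOTerm.var v ∈ a.args := by
  obtain ⟨p, l⟩ := a
  simp only [FOAtom.varsOf]
  induction l with
  | nil => simp
  | cons t l ih =>
    rw [List.foldr_cons, Finset.mem_union, ih]
    cases t <;> simp [FOTerm.varsOf]

lemma FOAtom.applySub_congr [DecidableEq V] {u u' : FOSubst V C} {a : FOAtom P V C}
    (h : ∀ v ∈ a.varsOf, u v = u' v) : a.applySub u = a.applySub u' := by
  simp only [FOAtom.applySub, FOAtom.mk.injEq, true_and]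
  refine List.map_congr_left fun t ht => FOTerm.applySub_congr fun v hv => h v ?_
  cases t with
  | var w =>
    rw [FOTerm.varsOf, Finset.mem_singleton] at hv
    exact FOAtom.mem_varsOf.2 (hv ▸ ht)
  | const c => simp [FOTerm.varsOf] at hv

lemma FOAtom.applySub_applySub (u u' : FOSubst V C) (a : FOAtom P V C) :
    (a.applySub u).applySub u' = a.applySub (fun v => (u v).applySub u') := by
  simp [FOAtom.applySub, FOTerm.applySub_applySub]

lemma mem_varsFS [DecidableEq V] {S : Finset (FOAtom P V C)} {v : V} :
    v ∈ varsFS S ↔ ∃ a ∈ S, v ∈ a.varsOf := by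
  simp [varsFS, Finset.mem_sup]

lemma IsHom.comp {g h : FOSubst V C} {S₁ S₂ S₃ : Finset (FOAtom P V C)}
    (hg : IsHom g S₂ S₃) (hh : IsHom h S₁ S₂) :
    IsHom (fun v => (h v).applySub g) S₁ S₃ := fun a ha =>
  FOAtom.applySub_applySub h g a ▸ hg _ (hh a ha)

/-- A homomorphism maps variables to terms whose variables occur in the target. -/
lemma IsHom.varsOf_subset [DecidableEq V] {h : FOSubst V C} {S₁ S₂ : Finset (FOAtom P V C)}
    (hh : IsHom h S₁ S₂) {v : V} (hv : v ∈ varsFS S₁) : (h v).varsOf ⊆ varsFS S₂ := by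
  obtain ⟨a, ha, hva⟩ := mem_varsFS.1 hv
  intro w hw
  refine mem_varsFS.2 ⟨_, hh a ha, FOAtom.mem_varsOf.2 ?_⟩
  refine List.mem_map.2 ⟨_, FOAtom.mem_varsOf.1 hva, ?_⟩
  cases hv' : h v with
  | var x => simp_all [FOTerm.varsOf, FOTerm.applySub]
  | const c => simp [hv', FOTerm.varsOf] at hw

lemma exists_isSafeExt [DecidableEq V] [Infinite V] (F : Finset (FOAtom P V C))
    (R : DisjRule P V C) (H : Finset (FOAtom P V C)) (h : FOSubst V C) :
    ∃ h' : FOSubst V C, IsSafeExt F R H h h' := by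
  have hinf : Infinite ((varsFS F : Set V)ᶜ : Set V) :=
    (varsFS F).finite_toSet.infinite_compl.to_subtype
  let E := varsFS H \ varsFS R.body
  obtain ⟨f, hf⟩ := exists_injective_nat E
  let e : E ↪ ((varsFS F : Set V)ᶜ : Set V) :=
    (⟨f, hf⟩ : E ↪ ℕ).trans (Infinite.natEmbedding _)
  refine ⟨fun v => if hv : v ∈ E then FOTerm.var (e ⟨v, hv⟩) else h v,
    fun v hv => dif_neg hv, fun v hv => ⟨e ⟨v, hv⟩, dif_pos hv, ?_⟩, fun v hv v' hv' heq => ?_⟩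
  · exact (e ⟨v, hv⟩).2
  · beta_reduce at heq
    rw [dif_pos hv, dif_pos hv', FOTerm.var.injEq] at heq
    exact congrArg Subtype.val (e.injective (Subtype.ext heq))

/-- A homomorphism from `F₂` to `F₁` extends to the results of applying a rule along a
trigger on `F₂` and along its image on `F₁`. -/
lemma entailsFS_union_safeExt [DecidableEq P] [DecidableEq V] [DecidableEq C]
    {F₁ F₂ : Finset (FOAtom P V C)} {g : FOSubst V C} (hg : IsHom g F₂ F₁)
    {R : DisjRule P V C} {h₂ : FOSubst V C} (htrig : IsTrigger R h₂ F₂)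
    {H : Finset (FOAtom P V C)} {h₁' h₂' : FOSubst V C}
    (hs₁ : IsSafeExt F₁ R H (fun v => (h₂ v).applySub g) h₁')
    (hs₂ : IsSafeExt F₂ R H h₂ h₂') :
    EntailsFS (F₁ ∪ applySubFS h₁' H) (F₂ ∪ applySubFS h₂' H) := by
  classical
  let E := varsFS H \ varsFS R.body
  let g' : FOSubst V C := fun w =>
    if hw : ∃ v ∈ E, h₂' v = FOTerm.var w then h₁' hw.choose else g w
  have hg'F : ∀ w ∈ varsFS F₂, g' w = g w := by
    intro w hw
    refine dif_neg ?_
    rintro ⟨v, hv, hvw⟩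
    obtain ⟨x, hx, hxF⟩ := hs₂.2.1 v hv
    rw [hvw, FOTerm.var.injEq] at hx
    exact hxF (hx ▸ hw)
  have hg'H : ∀ v ∈ varsFS H, (h₂' v).applySub g' = h₁' v := by
    intro v hvH
    by_cases hv : v ∈ E
    · obtain ⟨w, hw, -⟩ := hs₂.2.1 v hv
      have hex : ∃ v ∈ E, h₂' v = FOTerm.var w := ⟨v, hv, hw⟩
      have hchoose : hex.choose = v :=
        hs₂.2.2 _ hex.choose_spec.1 v hv (hex.choose_spec.2.trans hw.symm)
      rw [hw]
      change g' w = _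
      simp only [g', dif_pos hex, hchoose]
    · have hvB : v ∈ varsFS R.body := by
        by_contra hvB
        exact hv (Finset.mem_sdiff.2 ⟨hvH, hvB⟩)
      rw [hs₁.1 v hv, hs₂.1 v hv]
      exact FOTerm.applySub_congr fun w hw => hg'F w (htrig.varsOf_subset hvB hw)
  refine ⟨g', fun a ha => ?_⟩
  rcases Finset.mem_union.1 ha with ha | ha
  · refine Finset.mem_union_left _ ?_
    rw [FOAtom.applySub_congr fun v hv => hg'F v (mem_varsFS.2 ⟨a, ha, hv⟩)]
    exact hg a ha
  · obtain ⟨b, hb, rfl⟩ := Finset.mem_image.1 ha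
    refine Finset.mem_union_right _ (Finset.mem_image.2 ⟨b, hb, ?_⟩)
    rw [FOAtom.applySub_applySub]
    exact FOAtom.applySub_congr fun v hv => (hg'H v (mem_varsFS.2 ⟨b, hb, hv⟩)).symm

/-- preservation of entailment by α_∨: if `F₁ ⊨ F₂` and there is a
trigger `(R, h₂)` on `F₂`, then there is a trigger `(R, h₁)` on `F₁` with
`α_∨(F₁, R, h₁) ⊨ α_∨(F₂, R, h₂)` component-wise. -/
theorem stmt1 {P V C : Type} [DecidableEq P] [DecidableEq V] [DecidableEq C] [Infinite V]
    (F₁ F₂ : Finset (FOAtom P V C)) (hent : EntailsFS F₁ F₂)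
    (R : DisjRule P V C) (hWF : R.WF)
    (h₂ : FOSubst V C) (htrig₂ : IsTrigger R h₂ F₂)
    (L₂ : List (Finset (FOAtom P V C))) (hα₂ : IsAlpha F₂ R h₂ L₂) :
    ∃ h₁ : FOSubst V C, IsTrigger R h₁ F₁ ∧
      ∃ L₁ : List (Finset (FOAtom P V C)), IsAlpha F₁ R h₁ L₁ ∧
        L₁.length = L₂.length ∧
        ∀ (i : ℕ) (hi₁ : i < L₁.length) (hi₂ : i < L₂.length),
          EntailsFS (L₁.get ⟨i, hi₁⟩) (L₂.get ⟨i, hi₂⟩) := by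
  obtain ⟨g, hg⟩ := hent
  choose s hs using fun H => exists_isSafeExt F₁ R H (fun v => (h₂ v).applySub g)
  refine ⟨fun v => (h₂ v).applySub g, hg.comp htrig₂,
    R.heads.map fun H => F₁ ∪ applySubFS (s H) H, ⟨by simp, fun i hi hi' => ?_⟩,
    by simp [hα₂.1], fun i hi₁ hi₂ => ?_⟩
  · exact ⟨s _, hs _, by simp⟩
  · obtain ⟨h₂', hs₂, hL⟩ := hα₂.2 i hi₂ (hα₂.1 ▸ hi₂)
    rw [hL]
    simpa using entailsFS_union_safeExt hg htrig₂ (hs _) hs₂
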